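/- Fix positive integers k, b, an integer a with 1 ≤ a ≤ n, and a (deterministic) level assignment ℓ_1,…,ℓ_n ∈ {1,2,3,…} such that for every level ℓ ≥ 1, C_{ℓ, min(2^ℓ·b, n)} < k. Let f_1 ≥ … ≥ f_n ≥ 0 with F = ∑_{i=1}^n f_i, let c = (1/a)·∑_{i=n−a+1}^n f_i be the average of the a smallest values, and define I_i = 1 if C_{ℓ_i,i-1} < k and 0 otherwise, and p_i = ∑_{ℓ ≥ 1 : C_{ℓ,i-1} < k} 2^{-ℓ}. Then for every i ∈ {1,…,n}, |(I_i/p_i − 1)·(f_i − c)| ≤ F/b. -/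

import Mathlib

/-- `levelCount n L ℓ i` is `C_{ℓ,i}`: the number of points among the first `i`
(i.e. those `j : Fin n` with `(j : ℕ) < i`) assigned to level `ℓ` by `L`. -/
def levelCount (n : ℕ) (L : Fin n → ℕ) (ℓ : ℕ) (i : ℕ) : ℕ :=
  (Finset.univ.filter (fun j : Fin n => (j : ℕ) < i ∧ L j = ℓ)).card

/-- `pVal n k L m` is `p_i` for the point with `m = i − 1` previous points:
`∑_{ℓ ≥ 1 : C_{ℓ,m} < k} 2^{−ℓ}` (the sum over levels `ℓ ≥ 1` is written as a
`tsum` over `ℓ : ℕ` of the term at level `ℓ + 1`). -/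
noncomputable def pVal (n k : ℕ) (L : Fin n → ℕ) (m : ℕ) : ℝ :=
  ∑' ℓ : ℕ, if levelCount n L (ℓ + 1) m < k then (1 / 2 : ℝ) ^ (ℓ + 1) else 0

/-- `IVal n k L i` is the indicator `I_i = 1[C_{ℓ_i, i−1} < k]` for the point `i : Fin n`
(0-based, so it has `(i : ℕ)` previous points). -/
noncomputable def IVal (n k : ℕ) (L : Fin n → ℕ) (i : Fin n) : ℝ :=
  if levelCount n L (L i) (i : ℕ) < k then 1 else 0

open Finset

theorem levelCount_mono (n : ℕ) (L : Fin n → ℕ) (ℓ : ℕ) : Monotone (levelCount n L ℓ) := by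
  intro i j hij
  refine card_le_card fun x hx => ?_
  simp only [mem_filter, mem_univ, true_and] at hx ⊢
  exact ⟨hx.1.trans_le hij, hx.2⟩

theorem hasSum_half_pow_succ : HasSum (fun ℓ : ℕ => (1 / 2 : ℝ) ^ (ℓ + 1)) 1 := by
  simpa [pow_succ] using hasSum_geometric_two.mul_right (1 / 2 : ℝ)

theorem summable_pVal (n k : ℕ) (L : Fin n → ℕ) (m : ℕ) :
    Summable fun ℓ : ℕ =>
      if levelCount n L (ℓ + 1) m < k then (1 / 2 : ℝ) ^ (ℓ + 1) else 0 := by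
  refine hasSum_half_pow_succ.summable.of_nonneg_of_le (fun ℓ => ?_) (fun ℓ => ?_)
  · split_ifs <;> positivity
  · split_ifs
    · exact le_rfl
    · positivity

theorem pVal_le_one (n k : ℕ) (L : Fin n → ℕ) (m : ℕ) : pVal n k L m ≤ 1 := by
  rw [← hasSum_half_pow_succ.tsum_eq]
  refine (summable_pVal n k L m).tsum_le_tsum (fun ℓ => ?_) hasSum_half_pow_succ.summable
  split_ifs
  · exact le_rfl
  · positivity

theorem half_pow_le_pVal {n k : ℕ} {L : Fin n → ℕ} {m s : ℕ}
    (h : ∀ ℓ, s ≤ ℓ → levelCount n L (ℓ + 1) m < k) : (1 / 2 : ℝ) ^ s ≤ pVal n k L m := by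
  have htail : ∑' ℓ : ℕ, (if levelCount n L (ℓ + s + 1) m < k
      then (1 / 2 : ℝ) ^ (ℓ + s + 1) else 0) = (1 / 2) ^ s := by
    have hs := hasSum_half_pow_succ.mul_right ((1 / 2 : ℝ) ^ s)
    rw [one_mul] at hs
    rw [← hs.tsum_eq]
    refine tsum_congr fun ℓ => ?_
    rw [if_pos (h _ (Nat.le_add_left s ℓ))]
    ring
  rw [pVal, ← (summable_pVal n k L m).sum_add_tsum_nat_add s, htail]
  refine le_add_of_nonneg_left (sum_nonneg fun ℓ _ => ?_)
  split_ifs <;> positivity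

theorem card_mul_apply_le_sum {n : ℕ} {f : Fin n → ℝ} (hmono : ∀ i j : Fin n, i ≤ j → f j ≤ f i)
    (i : Fin n) : (i : ℕ) * f i ≤ ∑ j ∈ univ.filter (fun j : Fin n => (j : ℕ) < i), f j := by
  have hcard : (univ.filter (fun j : Fin n => (j : ℕ) < i)).card = i := by
    have : univ.filter (fun j : Fin n => (j : ℕ) < i) = Iio i := by ext; simp
    rw [this, Fin.card_Iio]
  rw [← nsmul_eq_mul]
  nth_rewrite 1 [← hcard]
  refine card_nsmul_le_sum _ _ _ fun j hj => hmono _ _ ?_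
  exact (mem_filter.1 hj).2.le

/-- The average of the `a` smallest values is at most the overall average. -/
theorem mul_tail_sum_le {n a : ℕ} (ha1 : 1 ≤ a) (han : a ≤ n) {f : Fin n → ℝ}
    (hmono : ∀ i j : Fin n, i ≤ j → f j ≤ f i) :
    n * ∑ i ∈ univ.filter (fun i : Fin n => n - a ≤ (i : ℕ)), f i ≤ a * ∑ i, f i := by
  let p : Fin n := ⟨n - a, by omega⟩
  have hsplit := sum_filter_add_sum_filter_not univ (fun i : Fin n => (i : ℕ) < n - a) f
  simp only [not_lt] at hsplit
  have hhead := card_mul_apply_le_sum hmono p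
  have hcard : (univ.filter (fun i : Fin n => n - a ≤ (i : ℕ))).card = a := by
    have : univ.filter (fun i : Fin n => n - a ≤ (i : ℕ)) = Ici p := by
      ext; simp [p, Fin.le_def]
    rw [this, Fin.card_Ici]
    simp only [p]
    omega
  have htail : ∑ i ∈ univ.filter (fun i : Fin n => n - a ≤ (i : ℕ)), f i ≤ a * f p := by
    have := sum_le_card_nsmul (univ.filter (fun i : Fin n => n - a ≤ (i : ℕ))) f (f p)
      fun j hj => hmono _ _ (mem_filter.1 hj).2
    rwa [hcard, nsmul_eq_mul] at this
  have hcast : ((n - a : ℕ) : ℝ) = n - a := Nat.cast_sub han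
  simp only [p, hcast] at hhead
  have hna : (a : ℝ) ≤ n := by exact_mod_cast han
  have ha0 : (0 : ℝ) ≤ a := by positivity
  rw [← hsplit]
  have h1 := mul_le_mul_of_nonneg_left htail (sub_nonneg.2 hna)
  have h2 := mul_le_mul_of_nonneg_left hhead ha0
  linarith

/-- The weight error at a point with `i` predecessors is at most `i / b`. -/
theorem abs_IVal_div_pVal_sub_one_le {n k b : ℕ} (hb : 0 < b) {L : Fin n → ℕ}
    (hL : ∀ j, 1 ≤ L j)
    (hgood : ∀ ℓ : ℕ, 1 ≤ ℓ → levelCount n L ℓ (min (2 ^ ℓ * b) n) < k) (i : Fin n) :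
    |IVal n k L i / pVal n k L (i : ℕ) - 1| ≤ (i : ℕ) / (b : ℝ) := by
  have hopen : ∀ ℓ, 1 ≤ ℓ → (i : ℕ) ≤ 2 ^ ℓ * b → levelCount n L ℓ i < k := fun ℓ h1 h2 =>
    (levelCount_mono n L ℓ (le_min h2 i.2.le)).trans_lt (hgood ℓ h1)
  have hlow : ∀ s, (i : ℕ) ≤ 2 ^ (s + 1) * b → (1 / 2 : ℝ) ^ s ≤ pVal n k L i := fun s hs =>
    half_pow_le_pVal fun ℓ hℓ => hopen _ (by omega) <| hs.trans <|
      Nat.mul_le_mul_right _ (Nat.pow_le_pow_right two_pos (by omega))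
  have hp1 := pVal_le_one n k L i
  have hb' : (0 : ℝ) < b := by exact_mod_cast hb
  have hex : ∃ s, (i : ℕ) ≤ 2 ^ (s + 1) * b :=
    ⟨i, (Nat.lt_two_pow_self.le.trans (Nat.pow_le_pow_right two_pos (Nat.le_succ _))).trans
      (Nat.le_mul_of_pos_right _ hb)⟩
  classical
  obtain ⟨s, hs, hmin⟩ : ∃ s, (i : ℕ) ≤ 2 ^ (s + 1) * b ∧ ∀ t < s, ¬ (i : ℕ) ≤ 2 ^ (t + 1) * b :=
    ⟨Nat.find hex, Nat.find_spec hex, fun t ht => Nat.find_min hex ht⟩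
  have hps := hlow s hs
  rcases s with _ | s
  · have hp : pVal n k L i = 1 := le_antisymm hp1 (by simpa using hps)
    have hI : IVal n k L i = 1 := if_pos <| hopen _ (hL i) <| hs.trans <|
      Nat.mul_le_mul_right _ (Nat.pow_le_pow_right two_pos (by simpa using hL i))
    rw [hp, hI]
    simp only [div_one, sub_self, abs_zero]
    positivity
  · have hbi : (2 : ℝ) ^ (s + 1) * b ≤ (i : ℕ) := by
      exact_mod_cast (not_le.1 (hmin s (Nat.lt_succ_self s))).le
    have hpos : (0 : ℝ) < (1 / 2) ^ (s + 1) := by positivity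
    have hinv : 1 / pVal n k L i ≤ (i : ℕ) / b := by
      refine (one_div_le_one_div_of_le hpos hps).trans ?_
      rw [one_div_pow, one_div_one_div, le_div_iff₀ hb']
      exact hbi
    have hone : 1 ≤ 1 / pVal n k L i := (one_le_div (hpos.trans_le hps)).2 hp1
    rw [IVal]
    split_ifs
    · rw [abs_of_nonneg (by linarith)]
      linarith
    · simpa using hone.trans hinv

/-- Fix positive integers `k`, `b`, an integer `a` with `1 ≤ a ≤ n`, and
a deterministic level assignment `ℓ_1,…,ℓ_n ∈ {1,2,3,…}` such that for every level `ℓ ≥ 1`,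
`C_{ℓ, min(2^ℓ·b, n)} < k`. Let `f_1 ≥ … ≥ f_n ≥ 0` with `F = ∑ f_i`, let
`c = (1/a)·∑_{i=n−a+1}^n f_i` be the average of the `a` smallest values, and define `I_i`
and `p_i` as above. Then for every `i ∈ {1,…,n}`, `|(I_i/p_i − 1)·(f_i − c)| ≤ F/b`.
(Indices are 0-based via `Fin n`: the `a` smallest values are those with 1-based index
`≥ n − a + 1`, i.e. `(i : ℕ) ≥ n − a`.) -/
theorem stmt_15 (n k b : ℕ) (hk : 0 < k) (hb : 0 < b)
    (a : ℕ) (ha1 : 1 ≤ a) (han : a ≤ n)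
    (L : Fin n → ℕ) (hL : ∀ j, 1 ≤ L j)
    (hgood : ∀ ℓ : ℕ, 1 ≤ ℓ → levelCount n L ℓ (min (2 ^ ℓ * b) n) < k)
    (f : Fin n → ℝ) (hmono : ∀ i j : Fin n, i ≤ j → f j ≤ f i) (hf : ∀ i, 0 ≤ f i)
    (c : ℝ)
    (hc : c = (1 / (a : ℝ)) * ∑ i ∈ Finset.univ.filter (fun i : Fin n => n - a ≤ (i : ℕ)), f i) :
    ∀ i : Fin n,
      |(IVal n k L i / pVal n k L (i : ℕ) - 1) * (f i - c)| ≤ (∑ j, f j) / (b : ℝ) := by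
  intro i
  have hb' : (0 : ℝ) < b := by exact_mod_cast hb
  have ha' : (0 : ℝ) < a := by exact_mod_cast ha1
  have hc0 : 0 ≤ c := hc ▸ mul_nonneg (by positivity) (sum_nonneg fun j _ => hf j)
  have hif : (i : ℕ) * f i ≤ ∑ j, f j := (card_mul_apply_le_sum hmono i).trans <|
    sum_le_sum_of_subset_of_nonneg (filter_subset _ _) fun j _ _ => hf j
  have hnc : n * c ≤ ∑ j, f j := by
    rw [hc, one_div, inv_mul_eq_div, ← mul_div_assoc, div_le_iff₀' ha']
    exact mul_tail_sum_le ha1 han hmono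
  have hic : (i : ℕ) * c ≤ ∑ j, f j :=
    (mul_le_mul_of_nonneg_right (by exact_mod_cast i.2.le) hc0).trans hnc
  have hdiff : (i : ℕ) * |f i - c| ≤ ∑ j, f j := by
    refine (mul_le_mul_of_nonneg_left (abs_sub_le_of_nonneg_of_le (hf i) (le_max_left _ _) hc0 (le_max_right _ _))
      (Nat.cast_nonneg _)).trans ?_
    rcases max_choice (f i) c with h | h <;> rwa [h]
  rw [abs_mul]
  calc _ ≤ (i : ℕ) / (b : ℝ) * |f i - c| :=
        mul_le_mul_of_nonneg_right (abs_IVal_div_pVal_sub_one_le hb hL hgood i) (abs_nonneg _)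
    _ = (i : ℕ) * |f i - c| / b := by ring
    _ ≤ _ := div_le_div_of_nonneg_right hdiff hb'.le
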